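/- Detailed balance for the shift generator (Lemma 5.3, shift part): In the pinned finite-volume setting, for all bounded measurable f, g : ℝ^{V∖{0̂}} → ℝ one has ∫ e^{−H₀(η)} g(η) (∫_ℝ f(η − (η̄(0̂) + σx)·𝟏) γ₁(dx)) dη = ∫ e^{−H₀(η)} f(η) (∫_ℝ g(η − (η̄(0̂) + σx)·𝟏) γ₁(dx)) dη, where 𝟏 ∈ ℝ^{V∖{0̂}} is the all-ones configuration and η̄(0̂) = ∑_{k∈V∖{0̂}} q(0̂,k) η(k). That is, the pinned Gibbs density is reversible for the update that shifts all heights by −(η̄(0̂) + σx) with x standard Gaussian (the process as seen from the height at the origin). -/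

import Mathlib

open MeasureTheory ProbabilityTheory

/-- A linear involution of a finite-dimensional real space preserves every Haar measure. -/
lemma measurePreserving_of_involutive_linearMap {E : Type*} [NormedAddCommGroup E]
    [NormedSpace ℝ E] [FiniteDimensional ℝ E] [MeasurableSpace E] [BorelSpace E]
    (μ : Measure E) [μ.IsAddHaarMeasure] (L : E →ₗ[ℝ] E) (hL : ∀ x, L (L x) = x) :
    MeasurePreserving L μ μ := by
  have hcomp : L ∘ₗ L = LinearMap.id := LinearMap.ext hL
  have hdet : LinearMap.det L * LinearMap.det L = 1 := by
    rw [← LinearMap.det_comp, hcomp, LinearMap.det_id]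
  have habs : |(LinearMap.det L)⁻¹| = 1 := by
    rcases mul_self_eq_one_iff.mp hdet with h | h <;> simp [h]
  refine ⟨L.continuous_of_finiteDimensional.measurable, ?_⟩
  rw [Measure.map_linearMap_addHaar_eq_smul_addHaar μ (left_ne_zero_of_mul_eq_one hdet), habs]
  simp

/-- A continuous, 2-homogeneous function on `ℝ^ι` which is positive away from the origin has an
integrable Gibbs weight. -/
lemma integrable_exp_neg_of_homogeneous {ι : Type*} [Fintype ι] (H : (ι → ℝ) → ℝ)
    (hc : Continuous H) (hsmul : ∀ (c : ℝ) η, H (c • η) = c ^ 2 * H η)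
    (hpos : ∀ η, η ≠ 0 → 0 < H η) : Integrable fun η => Real.exp (-H η) := by
  obtain ⟨c, hc0, hcH⟩ := (isCompact_sphere (0 : ι → ℝ) 1).exists_forall_le' (f := H)
    hc.continuousOn (a := 0) fun η hη => hpos η (ne_zero_of_mem_unit_sphere ⟨η, hη⟩)
  have hnorm : ∀ η : ι → ℝ, c * ‖η‖ ^ 2 ≤ H η := by
    intro η
    rcases eq_or_ne η 0 with rfl | hη
    · simpa using (hsmul 0 0).ge
    · have h1 := hcH (‖η‖⁻¹ • η) (by simp [norm_smul, hη])
      rw [hsmul, inv_pow, ← div_eq_inv_mul, le_div_iff₀ (by positivity)] at h1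
      exact h1
  set b : ℝ := c / (Fintype.card ι + 1) with hb
  have hb0 : 0 < b := by positivity
  have hdom : Integrable fun η : ι → ℝ => ∏ i, Real.exp (-b * η i ^ 2) :=
    Integrable.fintype_prod fun _ => integrable_exp_neg_mul_sq hb0
  refine hdom.mono' (by fun_prop) (Filter.Eventually.of_forall fun η => ?_)
  rw [Real.norm_eq_abs, Real.abs_exp, ← Real.exp_sum, Real.exp_le_exp]
  have hsum : ∑ i, b * η i ^ 2 ≤ ∑ _i : ι, b * ‖η‖ ^ 2 := by
    refine Finset.sum_le_sum fun i _ => ?_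
    have := sq_le_sq₀ (norm_nonneg (η i)) (norm_nonneg η) |>.mpr (norm_le_pi_norm η i)
    rw [Real.norm_eq_abs, sq_abs] at this
    gcongr
  have hcard : ∑ _i : ι, b * ‖η‖ ^ 2 ≤ c * ‖η‖ ^ 2 := by
    rw [Finset.sum_const, Finset.card_univ, nsmul_eq_mul, ← mul_assoc]
    gcongr
    rw [hb, mul_div_assoc', div_le_iff₀ (by positivity)]
    nlinarith
  have := hnorm η
  simp only [neg_mul, Finset.sum_neg_distrib]
  linarith

/-- The Dirichlet form of a symmetric stochastic matrix in terms of the quadratic form of `q`. -/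
lemma dirichlet_eq_dotProduct {V : Type*} [Fintype V] (q : Matrix V V ℝ)
    (hstoch : ∀ i, ∑ j, q i j = 1) (hsymm : ∀ i j, q i j = q j i) (e : V → ℝ) :
    ∑ i, ∑ j, q i j * (e i - e j) ^ 2 = 2 * (e ⬝ᵥ e - e ⬝ᵥ q.mulVec e) := by
  have h1 : ∑ i, ∑ j, q i j * e i ^ 2 = e ⬝ᵥ e := by
    simp only [← Finset.sum_mul, hstoch, dotProduct]
    exact Finset.sum_congr rfl fun i _ => by ring
  have h2 : ∑ i, ∑ j, q i j * e j ^ 2 = e ⬝ᵥ e := by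
    rw [Finset.sum_comm, ← h1]
    exact Finset.sum_congr rfl fun i _ => Finset.sum_congr rfl fun j _ => by rw [hsymm]
  have h3 : ∑ i, ∑ j, q i j * (e i * e j) = e ⬝ᵥ q.mulVec e := by
    simp only [dotProduct, Matrix.mulVec, Finset.mul_sum]
    exact Finset.sum_congr rfl fun i _ => Finset.sum_congr rfl fun j _ => by ring
  calc ∑ i, ∑ j, q i j * (e i - e j) ^ 2
      = ∑ i, ∑ j, q i j * e i ^ 2 + ∑ i, ∑ j, q i j * e j ^ 2
          - 2 * ∑ i, ∑ j, q i j * (e i * e j) := by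
        simp only [Finset.mul_sum, ← Finset.sum_add_distrib, ← Finset.sum_sub_distrib]
        exact Finset.sum_congr rfl fun i _ => Finset.sum_congr rfl fun j _ => by ring
    _ = _ := by rw [h1, h2, h3]; ring

/-- Effect on the Dirichlet form of raising the height at a single site. -/
lemma dirichlet_add_single {V : Type*} [Fintype V] [DecidableEq V] (q : Matrix V V ℝ)
    (hstoch : ∀ i, ∑ j, q i j = 1) (hsymm : ∀ i j, q i j = q j i) (v : V) (hv : q v v = 0)
    (e : V → ℝ) (he : e v = 0) (t : ℝ) :
    ∑ i, ∑ j, q i j * ((e + Pi.single v t : V → ℝ) i - (e + Pi.single v t : V → ℝ) j) ^ 2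
      = ∑ i, ∑ j, q i j * (e i - e j) ^ 2 - 4 * t * (∑ j, q v j * e j) + 2 * t ^ 2 := by
  rw [dirichlet_eq_dotProduct q hstoch hsymm, dirichlet_eq_dotProduct q hstoch hsymm]
  have h1 : q.mulVec e v = ∑ j, q v j * e j := rfl
  have h2 : e ⬝ᵥ q.mulVec (Pi.single v t) = t * ∑ j, q v j * e j := by
    simp only [dotProduct, Matrix.mulVec_single, Finset.mul_sum]
    exact Finset.sum_congr rfl fun j _ => by simp [hsymm v j]; ring
  have h3 : q.mulVec (Pi.single v t) v = 0 := by simp [hv]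
  simp only [Matrix.mulVec_add, dotProduct_add, add_dotProduct, single_dotProduct,
    dotProduct_single, h1, h2, h3, he, Pi.add_apply, Pi.single_eq_same]
  ring

/-- The Dirichlet form of an irreducible kernel vanishes only on constants. -/
lemma eq_of_dirichlet_eq_zero {V : Type*} [Fintype V] [DecidableEq V] (q : Matrix V V ℝ)
    (hnn : ∀ i j, 0 ≤ q i j) (hirr : ∀ i j, ∃ n : ℕ, 0 < (q ^ n) i j) (e : V → ℝ)
    (he : ∑ i, ∑ j, q i j * (e i - e j) ^ 2 = 0) (i j : V) : e i = e j := by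
  have hterm : ∀ i j, 0 ≤ q i j * (e i - e j) ^ 2 := fun i j => mul_nonneg (hnn i j) (sq_nonneg _)
  have hedge : ∀ i j, q i j ≠ 0 → e i = e j := by
    intro i j hij
    have h1 := (Finset.sum_eq_zero_iff_of_nonneg
      fun i _ => Finset.sum_nonneg fun j _ => hterm i j).mp he i (Finset.mem_univ i)
    have h2 := (Finset.sum_eq_zero_iff_of_nonneg fun j _ => hterm i j).mp h1 j (Finset.mem_univ j)
    exact sub_eq_zero.mp (pow_eq_zero_iff two_ne_zero |>.mp ((mul_eq_zero.mp h2).resolve_left hij))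
  have hpath : ∀ (n : ℕ) (j : V), (q ^ n) i j ≠ 0 → e i = e j := by
    intro n
    induction n with
    | zero =>
      intro j hj
      by_contra hne
      exact hj (by rw [pow_zero, Matrix.one_apply_ne fun h => hne (congrArg e h)])
    | succ n ih =>
      intro j hj
      rw [pow_succ, Matrix.mul_apply] at hj
      obtain ⟨k, -, hk⟩ := Finset.exists_ne_zero_of_sum_ne_zero hj
      exact (ih k (left_ne_zero_of_mul hk)).trans (hedge k j (right_ne_zero_of_mul hk))
  obtain ⟨n, hn⟩ := hirr i j
  exact hpath n j (ne_of_gt hn)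

/-- The involution `(η, x) ↦ (η - (m η + σ x) 𝟏, -m η / σ)` underlying the shift update. -/
noncomputable def shiftInvolution {ι : Type*} (m : (ι → ℝ) →ₗ[ℝ] ℝ) (σ : ℝ) :
    (ι → ℝ) × ℝ →ₗ[ℝ] (ι → ℝ) × ℝ where
  toFun p := (fun j => p.1 j - (m p.1 + σ * p.2), -m p.1 / σ)
  map_add' p r := by
    ext
    · simp; ring
    · simp; ring
  map_smul' c p := by
    ext
    · simp; ring
    · simp; ring

lemma shiftInvolution_involutive {ι : Type*} (m : (ι → ℝ) →ₗ[ℝ] ℝ) (hm : m (fun _ => 1) = 1)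
    {σ : ℝ} (hσ : σ ≠ 0) (p : (ι → ℝ) × ℝ) :
    shiftInvolution m σ (shiftInvolution m σ p) = p := by
  have h : m (fun j => p.1 j - (m p.1 + σ * p.2)) = -(σ * p.2) := by
    have : (fun j => p.1 j - (m p.1 + σ * p.2))
        = p.1 - (m p.1 + σ * p.2) • (fun _ => (1 : ℝ)) := by ext; simp
    rw [this, map_sub, map_smul, hm]
    simp
  ext
  · simp only [shiftInvolution, LinearMap.coe_mk, AddHom.coe_mk, h]
    field_simp
    ring
  · simp only [shiftInvolution, LinearMap.coe_mk, AddHom.coe_mk, h]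
    field_simp

/-- A shift update is reversible for the weight `exp (-H)` as soon as `H η + x² / 2` is invariant
under the shift involution. -/
lemma integral_shift_reversible {ι : Type*} [Fintype ι] (m : (ι → ℝ) →ₗ[ℝ] ℝ)
    (hm : m (fun _ => 1) = 1) {σ : ℝ} (hσ : σ ≠ 0) (H : (ι → ℝ) → ℝ)
    (hexp : Integrable fun η => Real.exp (-H η))
    (hinv : ∀ η x, H (fun j => η j - (m η + σ * x)) + (-m η / σ) ^ 2 / 2 = H η + x ^ 2 / 2)
    (f g : (ι → ℝ) → ℝ) (hf : Measurable f) (hg : Measurable g)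
    (hfb : ∃ C, ∀ η, |f η| ≤ C) (hgb : ∃ C, ∀ η, |g η| ≤ C) :
    ∫ η, Real.exp (-H η) * g η * ∫ x, f (fun j => η j - (m η + σ * x)) ∂(gaussianReal 0 1)
      = ∫ η, Real.exp (-H η) * f η *
          ∫ x, g (fun j => η j - (m η + σ * x)) ∂(gaussianReal 0 1) := by
  set T := shiftInvolution m σ with hT
  set w : (ι → ℝ) × ℝ → ℝ := fun p => Real.exp (-H p.1) * gaussianPDFReal 0 1 p.2 with hw
  have hTm : Measurable T := T.continuous_of_finiteDimensional.measurable
  have hwint : Integrable w (volume.prod volume) := hexp.mul_prod (integrable_gaussianPDFReal 0 1)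
  have hTT : ∀ p, T (T p) = p := shiftInvolution_involutive m hm hσ
  have hwT : ∀ p, w (T p) = w p := by
    rintro ⟨η, x⟩
    have := hinv η x
    simp only [hw, hT, shiftInvolution, LinearMap.coe_mk, AddHom.coe_mk, gaussianPDFReal,
      NNReal.coe_one, sub_zero, mul_one]
    rw [mul_left_comm, mul_left_comm (Real.exp (-H η)), ← Real.exp_add, ← Real.exp_add]
    congr 2
    linarith
  have hpres : MeasurePreserving T (volume.prod volume) (volume.prod volume) :=
    measurePreserving_of_involutive_linearMap _ T hTT
  have hprod : ∀ f g : (ι → ℝ) → ℝ, Measurable f → Measurable g →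
      (∃ C, ∀ η, |f η| ≤ C) → (∃ C, ∀ η, |g η| ≤ C) →
      ∫ η, Real.exp (-H η) * g η * ∫ x, f (fun j => η j - (m η + σ * x)) ∂(gaussianReal 0 1)
        = ∫ p, w p * (g p.1 * f (T p).1) ∂(volume.prod volume) := by
    rintro f g hf hg ⟨C, hC⟩ ⟨D, hD⟩
    have hbd : ∀ p : (ι → ℝ) × ℝ, ‖g p.1 * f (T p).1‖ ≤ D * C := fun p => by
      rw [norm_mul]
      exact mul_le_mul (hD _) (hC _) (norm_nonneg _) ((abs_nonneg _).trans (hD p.1))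
    have hmeas : Measurable fun p : (ι → ℝ) × ℝ => g p.1 * f (T p).1 :=
      (hg.comp measurable_fst).mul (hf.comp (measurable_fst.comp hTm))
    have hI : Integrable (fun p => w p * (g p.1 * f (T p).1)) (volume.prod volume) :=
      hwint.mul_bdd hmeas.aestronglyMeasurable (Filter.Eventually.of_forall hbd)
    rw [integral_prod _ hI]
    congr 1 with η
    rw [integral_gaussianReal_eq_integral_smul one_ne_zero, ← integral_const_mul]
    congr 1 with x
    simp only [hw, hT, shiftInvolution, LinearMap.coe_mk, AddHom.coe_mk, smul_eq_mul]
    ring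
  rw [hprod f g hf hg hfb hgb, hprod g f hg hf hgb hfb]
  have hemb : MeasurableEmbedding T :=
    (MeasurableEquiv.mk (Equiv.mk T T hTT hTT) hTm hTm).measurableEmbedding
  rw [← hpres.integral_comp hemb]
  congr 1 with p
  rw [hTT, hwT]
  ring

/-- Detailed balance for the shift generator (Lemma 5.3, shift part): the pinned Gibbs
density is reversible for the update shifting all heights by `−(η̄(0̂) + σx)` with `x`
standard Gaussian (the process as seen from the height at the origin). -/
theorem stmt3 (V : Type) [Fintype V] [DecidableEq V] (v₀ : V) (σ : ℝ) (hσ : 0 < σ)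
    (q : Matrix V V ℝ)
    (hnn : ∀ i j, 0 ≤ q i j)
    (hstoch : ∀ i, ∑ j, q i j = 1)
    (hsymm : ∀ i j, q i j = q j i)
    (hdiag : ∀ i, q i i = 0)
    (hirr : ∀ i j, ∃ n : ℕ, 0 < (q ^ n) i j)
    -- `ext η` is the extension `η̂` of `η` to `V` with `η̂ v₀ = 0`
    (ext : ({v : V // v ≠ v₀} → ℝ) → V → ℝ)
    (hext : ∀ η v, ext η v = if h : v = v₀ then 0 else η ⟨v, h⟩)
    -- the pinned Hamiltonian: the sum over unordered pairs of distinct points of `V`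
    -- is written as half the sum over ordered pairs
    (H₀ : ({v : V // v ≠ v₀} → ℝ) → ℝ)
    (hH : ∀ η, H₀ η = (1 / (2 * σ ^ 2)) * ((1 / 2) *
      ∑ i : V, ∑ j : V,
        if i ≠ j then q i j * (ext η i - ext η j) ^ 2 else 0))
    -- `etabar η k = ∑_j q(k,j) η̂(j)`
    (etabar : ({v : V // v ≠ v₀} → ℝ) → V → ℝ)
    (hbar : ∀ η k, etabar η k = ∑ j, q k j * ext η j) :
    ∀ f g : ({v : V // v ≠ v₀} → ℝ) → ℝ,
      Measurable f → Measurable g →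
      (∃ C, ∀ η, |f η| ≤ C) → (∃ C, ∀ η, |g η| ≤ C) →
      ∫ η : {v : V // v ≠ v₀} → ℝ, Real.exp (-(H₀ η)) * g η *
          (∫ x, f (fun j => η j - ((∑ l : {v : V // v ≠ v₀}, q v₀ (l : V) * η l) + σ * x))
            ∂(gaussianReal 0 1))
        = ∫ η : {v : V // v ≠ v₀} → ℝ, Real.exp (-(H₀ η)) * f η *
          (∫ x, g (fun j => η j - ((∑ l : {v : V // v ≠ v₀}, q v₀ (l : V) * η l) + σ * x))
            ∂(gaussianReal 0 1)) := by
  intro f g hf hg hfb hgb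
  have hext₀ : ∀ η, ext η v₀ = 0 := fun η => by simp [hext]
  have hext₁ : ∀ η (l : {v : V // v ≠ v₀}), ext η l = η l := fun η l => by simp [hext, l.2]
  have hsum : ∀ a : V → ℝ, ∑ l : {v : V // v ≠ v₀}, q v₀ l * a l = ∑ j, q v₀ j * a j := by
    intro a
    rw [← Fintype.sum_subtype_add_sum_subtype (fun v => v ≠ v₀) fun j => q v₀ j * a j,
      left_eq_add]
    refine Finset.sum_eq_zero fun j _ => ?_
    rw [not_not.mp j.2, hdiag, zero_mul]
  have hH' : ∀ η, H₀ η = (1 / (2 * σ ^ 2)) * ((1 / 2) *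
      ∑ i, ∑ j, q i j * (ext η i - ext η j) ^ 2) := by
    intro η
    rw [hH]
    congr 3 with i
    congr 1 with j
    split_ifs with hij
    · rfl
    · rw [not_not.mp hij]; simp
  have hcont : Continuous H₀ := by
    have hc : ∀ v, Continuous fun η => ext η v := by
      intro v
      by_cases h : v = v₀
      · simp only [hext, h, dite_true]; fun_prop
      · simp only [hext, h, dite_false]; fun_prop
    rw [funext hH']
    fun_prop
  have hsmul : ∀ (c : ℝ) η, H₀ (c • η) = c ^ 2 * H₀ η := by
    intro c η
    have he : ∀ v, ext (c • η) v = c * ext η v := by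
      intro v
      by_cases h : v = v₀ <;> simp [hext, h]
    have hS : ∑ i, ∑ j, q i j * (c * ext η i - c * ext η j) ^ 2
        = c ^ 2 * ∑ i, ∑ j, q i j * (ext η i - ext η j) ^ 2 := by
      simp only [Finset.mul_sum]
      exact Finset.sum_congr rfl fun i _ => Finset.sum_congr rfl fun j _ => by ring
    simp only [hH', he, hS]
    ring
  have hpos : ∀ η, η ≠ 0 → 0 < H₀ η := by
    intro η hη
    have hS : 0 ≤ ∑ i, ∑ j, q i j * (ext η i - ext η j) ^ 2 :=
      Finset.sum_nonneg fun i _ => Finset.sum_nonneg fun j _ =>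
        mul_nonneg (hnn i j) (sq_nonneg _)
    rw [hH']
    have : 0 < ∑ i, ∑ j, q i j * (ext η i - ext η j) ^ 2 := by
      refine hS.lt_of_ne' fun h0 => hη (funext fun l => ?_)
      rw [← hext₁ η l, eq_of_dirichlet_eq_zero q hnn hirr _ h0 l v₀, hext₀, Pi.zero_apply]
    positivity
  let m : ({v : V // v ≠ v₀} → ℝ) →ₗ[ℝ] ℝ :=
    ∑ l : {v : V // v ≠ v₀}, q v₀ (l : V) • LinearMap.proj l
  have hmη : ∀ η, m η = ∑ l : {v : V // v ≠ v₀}, q v₀ (l : V) * η l := fun η => by simp [m]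
  have hm1 : m (fun _ => 1) = 1 := by
    rw [hmη, hsum fun _ => 1]
    simpa using hstoch v₀
  have hinv : ∀ η x, H₀ (fun j => η j - (m η + σ * x)) + (-m η / σ) ^ 2 / 2
      = H₀ η + x ^ 2 / 2 := by
    intro η x
    set t := m η + σ * x with ht
    have hshift : ∀ v, ext (fun j => η j - t) v = (ext η + Pi.single v₀ t : V → ℝ) v - t := by
      intro v
      by_cases h : v = v₀
      · subst h; simp [hext]
      · simp [hext, h]
    have hmext : ∑ j, q v₀ j * ext η j = m η := by
      rw [hmη, ← hsum]
      simp only [hext₁]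
    rw [hH', hH']
    simp only [hshift, sub_sub_sub_cancel_right]
    rw [dirichlet_add_single q hstoch hsymm v₀ (hdiag v₀) _ (hext₀ η), hmext, ht]
    field_simp
    ring
  simpa only [hmη] using integral_shift_reversible m hm1 hσ.ne' H₀
    (integrable_exp_neg_of_homogeneous H₀ hcont hsmul hpos) hinv f g hf hg hfb hgb
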